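/- If r_0 = 1 then f(X) = [0, 1/2], and if r_0 = −1 then f(X) = [−1/2, 0]. -/

import Mathlib

/-- `phi x` is the distance from `x` to the nearest integer. -/
noncomputable def phi (x : ℝ) : ℝ := |x - round x|

/-- The signed Takagi function associated to the sign sequence `r`. -/
noncomputable def takagi (r : ℕ → ℝ) (x : ℝ) : ℝ :=
  ∑' n : ℕ, r n / 2 ^ n * phi (2 ^ n * x)

/-- `eps n x` is the `n`-th binary digit of `x ∈ [0,1)` (for `n ≥ 1`), using the
terminating expansion for dyadic rationals. -/
noncomputable def eps (n : ℕ) (x : ℝ) : ℕ := (⌊2 ^ n * x⌋ % 2).toNat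

/-- `Dfun r k x = ∑_{j=1}^k r_{j-1} (-1)^{ε_j(x)}`. -/
noncomputable def Dfun (r : ℕ → ℝ) (k : ℕ) (x : ℝ) : ℝ :=
  ∑ j ∈ Finset.Icc 1 k, r (j - 1) * (-1 : ℝ) ^ eps j x

/-- `(k, m)` is a balanced pair if `0 ≤ k < 2^{2m}` and `D_{2m}(k/2^{2m}) = 0`. -/
def BalancedPair (r : ℕ → ℝ) (k m : ℕ) : Prop :=
  k < 2 ^ (2 * m) ∧ Dfun r (2 * m) ((k : ℝ) / 2 ^ (2 * m)) = 0

/-- The generation of a balanced pair `(k, m)`: the number of indices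
`1 ≤ j ≤ 2m` with `D_j(k/2^{2m}) = 0`. -/
noncomputable def generation (r : ℕ → ℝ) (k m : ℕ) : ℕ :=
  {j : ℕ | 1 ≤ j ∧ j ≤ 2 * m ∧ Dfun r j ((k : ℝ) / 2 ^ (2 * m)) = 0}.ncard

/-- The set `X = [0,1] \ ⋃ (k/2^{2m}, (k+1)/2^{2m})`, the union taken over all
balanced pairs `(k, m)` of generation `1`. -/
noncomputable def XSet (r : ℕ → ℝ) : Set ℝ :=
  Set.Icc (0 : ℝ) 1 \
    ⋃ p : ℕ × ℕ, ⋃ _ : BalancedPair r p.1 p.2 ∧ generation r p.1 p.2 = 1,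
      Set.Ioo ((p.1 : ℝ) / 2 ^ (2 * p.2)) (((p.1 : ℝ) + 1) / 2 ^ (2 * p.2))

open Set Filter Topology

lemma phi_le_abs_sub (x : ℝ) (z : ℤ) : phi x ≤ |x - z| := round_le x z

lemma phi_nonneg (x : ℝ) : 0 ≤ phi x := abs_nonneg _

lemma phi_le_half (x : ℝ) : phi x ≤ 1 / 2 := abs_sub_round x

lemma continuous_phi : Continuous phi := by
  have h : LipschitzWith 1 phi := by
    refine LipschitzWith.of_le_add fun x y => ?_
    have h1 := phi_le_abs_sub x (round y)
    have h2 := abs_sub_le x y (round y)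
    rw [Real.dist_eq]
    have h3 : phi y = |y - round y| := rfl
    linarith
  exact h.continuous

lemma phi_eq_sub {x : ℝ} {t : ℤ} (h0 : (t : ℝ) ≤ x) (h1 : x ≤ t + 1 / 2) : phi x = x - t := by
  have hf : Int.fract x = x - t := by
    rw [Int.fract, Int.floor_eq_iff.2 ⟨h0, by linarith⟩]
  rw [phi, abs_sub_round_eq_min, hf, min_eq_left (by linarith)]

lemma phi_eq_sub' {x : ℝ} {t : ℤ} (h0 : (t : ℝ) + 1 / 2 ≤ x) (h1 : x ≤ t + 1) :
    phi x = t + 1 - x := by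
  rcases h1.eq_or_lt with h | h
  · have := phi_eq_sub (x := x) (t := t + 1) (by push_cast; linarith) (by push_cast; linarith)
    rw [this]; push_cast; linarith
  · have hf : Int.fract x = x - t := by
      rw [Int.fract, Int.floor_eq_iff.2 ⟨by linarith, h⟩]
    rw [phi, abs_sub_round_eq_min, hf, min_eq_right (by linarith)]
    ring

lemma phi_natCast (k : ℕ) : phi k = 0 := by
  rw [phi_eq_sub (t := (k : ℤ)) (by simp) (by simp)]; simp

lemma phi_natCast_add_half (k : ℕ) : phi (k + 1 / 2) = 1 / 2 := by
  rw [phi_eq_sub (t := (k : ℤ)) (by simp) (by simp)]; simp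

/-- `phi` is affine between consecutive half-integers. -/
lemma phi_midpoint {u v : ℝ} (q : ℕ) (hu : (q : ℝ) / 2 ≤ u) (hu' : u ≤ (q + 1) / 2)
    (hv : (q : ℝ) / 2 ≤ v) (hv' : v ≤ (q + 1) / 2) :
    phi ((u + v) / 2) = (phi u + phi v) / 2 := by
  rcases Nat.even_or_odd' q with ⟨t, rfl | rfl⟩
  · push_cast at *
    rw [phi_eq_sub (x := u) (t := t), phi_eq_sub (x := v) (t := t),
      phi_eq_sub (x := (u + v) / 2) (t := t)]
    · ring
    all_goals push_cast; linarith
  · push_cast at *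
    rw [phi_eq_sub' (x := u) (t := t), phi_eq_sub' (x := v) (t := t),
      phi_eq_sub' (x := (u + v) / 2) (t := t)]
    · ring
    all_goals push_cast; linarith

/-- Effect of a dyadic midpoint on the `i`-th scaled copy of `phi`. -/
lemma phi_dyadic_midpoint (n k i : ℕ) :
    phi (2 ^ i * (((2 * k + 1 : ℕ) : ℝ) / 2 ^ (n + 1))) =
      (phi (2 ^ i * ((k : ℝ) / 2 ^ n)) + phi (2 ^ i * (((k + 1 : ℕ) : ℝ) / 2 ^ n))) / 2
        + if i = n then 1 / 2 else 0 := by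
  rcases lt_trichotomy i n with h | rfl | h
  · obtain ⟨p, rfl⟩ := Nat.exists_eq_add_of_lt h
    rw [if_neg h.ne, add_zero]
    have hp : (0 : ℝ) < 2 ^ p := by positivity
    have e : ∀ z : ℝ, 2 ^ i * (z / 2 ^ (i + p + 1)) = z / 2 ^ p / 2 := by
      intro z; field_simp; ring
    have e' : 2 ^ i * (((2 * k + 1 : ℕ) : ℝ) / 2 ^ (i + p + 1 + 1)) =
        ((k : ℝ) / 2 ^ p / 2 + ((k + 1 : ℕ) : ℝ) / 2 ^ p / 2) / 2 := by
      push_cast; field_simp; ring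
    rw [e', e, e]
    have h1 : ((k / 2 ^ p : ℕ) : ℝ) * 2 ^ p ≤ k := by exact_mod_cast Nat.div_mul_le_self k (2 ^ p)
    have h2 : (k : ℝ) + 1 ≤ ((k / 2 ^ p : ℕ) + 1) * 2 ^ p := by
      have : k < (k / 2 ^ p + 1) * 2 ^ p := by
        rw [mul_comm]; exact Nat.lt_mul_div_succ k (by positivity)
      exact_mod_cast this
    have a1 := (le_div_iff₀ hp).2 h1
    have a2 := (div_le_iff₀ hp).2 h2
    have a3 : (k : ℝ) / 2 ^ p ≤ (k + 1) / 2 ^ p := by gcongr; linarith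
    apply phi_midpoint (k / 2 ^ p) <;> push_cast <;> linarith
  · have e : ∀ z : ℝ, 2 ^ i * (z / 2 ^ i) = z := by intro z; field_simp
    have e' : 2 ^ i * (((2 * k + 1 : ℕ) : ℝ) / 2 ^ (i + 1)) = (k : ℝ) + 1 / 2 := by
      push_cast; field_simp; ring
    rw [e, e, e', phi_natCast, phi_natCast, phi_natCast_add_half]
    simp
  · obtain ⟨p, rfl⟩ := Nat.exists_eq_add_of_lt h
    have e : ∀ z : ℕ, 2 ^ (n + p + 1) * ((z : ℝ) / 2 ^ n) = ((2 ^ (p + 1) * z : ℕ) : ℝ) := by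
      intro z; push_cast; field_simp; ring
    have e' : 2 ^ (n + p + 1) * (((2 * k + 1 : ℕ) : ℝ) / 2 ^ (n + 1)) =
        ((2 ^ p * (2 * k + 1) : ℕ) : ℝ) := by
      push_cast; field_simp; ring
    rw [e, e, e', phi_natCast, phi_natCast, phi_natCast, if_neg (by omega)]
    simp

section Takagi

variable {r : ℕ → ℝ}

lemma abs_takagi_term_le (hr : ∀ n, r n = 1 ∨ r n = -1) (n : ℕ) (x : ℝ) :
    ‖r n / 2 ^ n * phi (2 ^ n * x)‖ ≤ (1 / 2) ^ n := by
  have h1 : |r n| = 1 := by rcases hr n with h | h <;> simp [h]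
  rw [Real.norm_eq_abs, abs_mul, abs_div, h1, abs_of_nonneg (phi_nonneg _),
    abs_of_pos (by positivity), one_div_pow]
  have := phi_le_half (2 ^ n * x)
  have h2 : (0 : ℝ) < 1 / 2 ^ n := by positivity
  nlinarith

lemma summable_takagi (hr : ∀ n, r n = 1 ∨ r n = -1) (x : ℝ) :
    Summable fun n : ℕ => r n / 2 ^ n * phi (2 ^ n * x) :=
  Summable.of_norm_bounded summable_geometric_two fun n => abs_takagi_term_le hr n x

lemma continuous_takagi (hr : ∀ n, r n = 1 ∨ r n = -1) : Continuous (takagi r) := by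
  refine continuous_tsum (fun n => ?_) summable_geometric_two fun n x =>
    abs_takagi_term_le hr n x
  exact continuous_const.mul (continuous_phi.comp (by fun_prop))

lemma takagi_natCast (r : ℕ → ℝ) (k : ℕ) : takagi r k = 0 := by
  have : ∀ n : ℕ, r n / 2 ^ n * phi (2 ^ n * (k : ℝ)) = 0 := by
    intro n
    have h := phi_natCast (2 ^ n * k)
    push_cast at h
    rw [h, mul_zero]
  simp [takagi, this]

lemma takagi_midpoint (hr : ∀ n, r n = 1 ∨ r n = -1) (n k : ℕ) :
    takagi r (((2 * k + 1 : ℕ) : ℝ) / 2 ^ (n + 1)) =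
      (takagi r ((k : ℝ) / 2 ^ n) + takagi r (((k + 1 : ℕ) : ℝ) / 2 ^ n)) / 2
        + r n / 2 ^ (n + 1) := by
  have h1 := (summable_takagi hr ((k : ℝ) / 2 ^ n)).hasSum
  have h2 := (summable_takagi hr (((k + 1 : ℕ) : ℝ) / 2 ^ n)).hasSum
  have h3 := hasSum_ite_eq n (r n / 2 ^ (n + 1))
  have h := ((h1.add h2).div_const 2).add h3
  refine Eq.trans (tsum_congr fun i => ?_) h.tsum_eq
  rw [phi_dyadic_midpoint]
  split_ifs with hi
  · subst hi; rw [pow_succ]; ring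
  · ring

lemma floor_two_pow_mul {j n : ℕ} (h : j ≤ n) (x : ℝ) :
    ⌊2 ^ j * x⌋ = ⌊2 ^ n * x⌋ / ((2 ^ (n - j) : ℕ) : ℤ) := by
  obtain ⟨p, rfl⟩ := Nat.exists_eq_add_of_le h
  rw [← Int.floor_div_natCast]
  congr 1
  rw [Nat.add_sub_cancel_left]
  push_cast
  field_simp
  ring

lemma Dfun_congr {x y : ℝ} {j n : ℕ} (hj : j ≤ n) (h : ⌊2 ^ n * x⌋ = ⌊2 ^ n * y⌋) :
    Dfun r j x = Dfun r j y := by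
  refine Finset.sum_congr rfl fun i hi => ?_
  have hin : i ≤ n := (Finset.mem_Icc.1 hi).2.trans hj
  rw [eps, eps, floor_two_pow_mul hin, floor_two_pow_mul hin y, h]

lemma Dfun_zero (r : ℕ → ℝ) (x : ℝ) : Dfun r 0 x = 0 := by simp [Dfun]

lemma Dfun_succ (r : ℕ → ℝ) (n : ℕ) (x : ℝ) :
    Dfun r (n + 1) x = Dfun r n x + r n * (-1) ^ eps (n + 1) x := by
  rw [Dfun, Finset.sum_Icc_succ_top (by omega)]
  rfl

lemma floor_two_pow_mul_div (n k : ℕ) : ⌊(2 : ℝ) ^ n * ((k : ℝ) / 2 ^ n)⌋ = k := by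
  rw [mul_div_cancel₀ _ (by positivity)]; simp

lemma Dfun_child (r : ℕ → ℝ) (n k e : ℕ) (he : e < 2) :
    Dfun r (n + 1) (((2 * k + e : ℕ) : ℝ) / 2 ^ (n + 1)) =
      Dfun r n ((k : ℝ) / 2 ^ n) + r n * (-1) ^ e := by
  rw [Dfun_succ]
  have hD : Dfun r n (((2 * k + e : ℕ) : ℝ) / 2 ^ (n + 1)) = Dfun r n ((k : ℝ) / 2 ^ n) := by
    apply Dfun_congr le_rfl
    rw [floor_two_pow_mul_div, floor_two_pow_mul (Nat.le_succ n), floor_two_pow_mul_div]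
    simp
    omega
  have heps : eps (n + 1) (((2 * k + e : ℕ) : ℝ) / 2 ^ (n + 1)) = e := by
    rw [eps, floor_two_pow_mul_div]
    omega
  rw [hD, heps]

/-- `Dfun r n` is the slope of the `n`-th approximation of the Takagi function. -/
lemma takagi_sub (hr : ∀ n, r n = 1 ∨ r n = -1) (n k : ℕ) :
    takagi r (((k + 1 : ℕ) : ℝ) / 2 ^ n) - takagi r ((k : ℝ) / 2 ^ n) =
      Dfun r n ((k : ℝ) / 2 ^ n) / 2 ^ n := by
  induction n generalizing k with
  | zero =>
    rw [Dfun_zero, pow_zero, div_one, div_one, takagi_natCast, takagi_natCast]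
    simp
  | succ n ih =>
    have double : ∀ q : ℕ, ((2 * q : ℕ) : ℝ) / 2 ^ (n + 1) = (q : ℝ) / 2 ^ n := by
      intro q; push_cast; field_simp; ring
    rcases Nat.even_or_odd' k with ⟨q, rfl | rfl⟩
    · have hD := Dfun_child r n q 0 (by norm_num)
      have hq := ih q
      rw [add_zero] at hD
      rw [hD, takagi_midpoint hr, double, add_div, pow_succ]
      rw [sub_eq_iff_eq_add] at hq
      rw [hq]
      field_simp
      ring
    · have hD := Dfun_child r n q 1 (by norm_num)
      have hq := ih q
      rw [hD, takagi_midpoint hr, show 2 * q + 1 + 1 = 2 * (q + 1) by ring, double, add_div,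
        pow_succ]
      rw [sub_eq_iff_eq_add] at hq
      rw [hq]
      field_simp
      ring

lemma exists_int_Dfun_eq (hr : ∀ n, r n = 1 ∨ r n = -1) (n : ℕ) (x : ℝ) :
    ∃ z : ℤ, Dfun r n x = z ∧ (2 : ℤ) ∣ z - n := by
  induction n with
  | zero => exact ⟨0, by simp [Dfun_zero]⟩
  | succ n ih =>
    obtain ⟨z, hz, hd⟩ := ih
    rw [Dfun_succ, hz]
    have : r n * (-1) ^ eps (n + 1) x = 1 ∨ r n * (-1) ^ eps (n + 1) x = -1 := by
      rcases hr n with h | h <;> rcases neg_one_pow_eq_or ℝ (eps (n + 1) x) with h' | h' <;>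
        simp [h, h']
    rcases this with h | h <;> rw [h]
    · exact ⟨z + 1, by push_cast; ring, by push_cast; omega⟩
    · exact ⟨z - 1, by push_cast; ring, by push_cast; omega⟩

lemma takagi_midpoint_mem_uIcc (hr : ∀ n, r n = 1 ∨ r n = -1) (n k : ℕ)
    (hD : Dfun r n ((k : ℝ) / 2 ^ n) ≠ 0) :
    takagi r (((2 * k + 1 : ℕ) : ℝ) / 2 ^ (n + 1)) ∈
      uIcc (takagi r ((k : ℝ) / 2 ^ n)) (takagi r (((k + 1 : ℕ) : ℝ) / 2 ^ n)) := by
  have hs := takagi_sub hr n k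
  obtain ⟨z, hz, -⟩ := exists_int_Dfun_eq hr n ((k : ℝ) / 2 ^ n)
  rw [takagi_midpoint hr, mem_uIcc]
  rw [hz] at hs hD
  set A := takagi r ((k : ℝ) / 2 ^ n)
  set B := takagi r (((k + 1 : ℕ) : ℝ) / 2 ^ n)
  have hz0 : z ≠ 0 := by exact_mod_cast hD
  have hp : (0 : ℝ) < 1 / 2 ^ n := by positivity
  have hs' : B - A = z * (1 / 2 ^ n) := by rw [hs]; ring
  have hrn : r n / 2 ^ (n + 1) = r n * (1 / 2 ^ n) / 2 := by rw [pow_succ]; field_simp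
  rw [hrn]
  have hr2 : -1 ≤ r n ∧ r n ≤ 1 := by rcases hr n with h | h <;> rw [h] <;> norm_num
  rcases lt_or_gt_of_ne hz0 with h | h
  · have h1 : (z : ℝ) ≤ -1 := by exact_mod_cast Int.le_sub_one_of_lt h
    right; constructor <;> nlinarith
  · have h1 : (1 : ℝ) ≤ z := by exact_mod_cast h
    left; constructor <;> nlinarith

lemma mem_Ico_floor {x : ℝ} (hx : 0 ≤ x) (n : ℕ) :
    x ∈ Ico ((⌊2 ^ n * x⌋₊ : ℝ) / 2 ^ n) (((⌊2 ^ n * x⌋₊ + 1 : ℕ) : ℝ) / 2 ^ n) := by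
  have hp : (0 : ℝ) < 2 ^ n := by positivity
  refine ⟨(div_le_iff₀' hp).2 (Nat.floor_le (by positivity)), (lt_div_iff₀' hp).2 ?_⟩
  push_cast
  exact Nat.lt_floor_add_one _

lemma Dfun_floor (r : ℕ → ℝ) {x : ℝ} (hx : 0 ≤ x) {j n : ℕ} (hj : j ≤ n) :
    Dfun r j ((⌊2 ^ n * x⌋₊ : ℝ) / 2 ^ n) = Dfun r j x := by
  apply Dfun_congr hj
  rw [floor_two_pow_mul_div, Int.natCast_floor_eq_floor (by positivity)]

lemma natFloor_two_pow_succ (n : ℕ) (x : ℝ) :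
    ⌊2 ^ (n + 1) * x⌋₊ / 2 = ⌊2 ^ n * x⌋₊ := by
  rw [← Nat.floor_div_ofNat]
  congr 1
  rw [pow_succ]
  ring

/-- As long as the slopes have not vanished, the values of the Takagi function at the endpoints of
the dyadic intervals around `x` stay between `0` and `r 0 / 2`. -/
lemma takagi_endpoints_mem (hr : ∀ n, r n = 1 ∨ r n = -1) {x : ℝ} (hx : x ∈ Ico (0 : ℝ) 1)
    (n : ℕ) (hD : ∀ j, 1 ≤ j → j ≤ n → Dfun r j x ≠ 0) :
    takagi r ((⌊2 ^ (n + 1) * x⌋₊ : ℝ) / 2 ^ (n + 1)) ∈ uIcc 0 (r 0 / 2) ∧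
    takagi r (((⌊2 ^ (n + 1) * x⌋₊ + 1 : ℕ) : ℝ) / 2 ^ (n + 1)) ∈ uIcc 0 (r 0 / 2) := by
  have key : ∀ n k q : ℕ, k / 2 = q →
      takagi r ((q : ℝ) / 2 ^ n) ∈ uIcc 0 (r 0 / 2) →
      takagi r (((2 * q + 1 : ℕ) : ℝ) / 2 ^ (n + 1)) ∈ uIcc 0 (r 0 / 2) →
      takagi r (((q + 1 : ℕ) : ℝ) / 2 ^ n) ∈ uIcc 0 (r 0 / 2) →
      takagi r ((k : ℝ) / 2 ^ (n + 1)) ∈ uIcc 0 (r 0 / 2) ∧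
      takagi r (((k + 1 : ℕ) : ℝ) / 2 ^ (n + 1)) ∈ uIcc 0 (r 0 / 2) := by
    intro n k q hq h0 h1 h2
    have double : ∀ q : ℕ, ((2 * q : ℕ) : ℝ) / 2 ^ (n + 1) = (q : ℝ) / 2 ^ n := by
      intro q; push_cast; field_simp; ring
    rcases (by omega : k = 2 * q ∨ k = 2 * q + 1) with rfl | rfl
    · rw [double]; exact ⟨h0, h1⟩
    · rw [show 2 * q + 1 + 1 = 2 * (q + 1) by ring, double]; exact ⟨h1, h2⟩
  induction n with
  | zero =>
    have hq : ⌊(2 : ℝ) ^ (0 + 1) * x⌋₊ / 2 = 0 := by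
      rw [natFloor_two_pow_succ, pow_zero, one_mul]
      exact Nat.floor_eq_zero.2 hx.2
    have hm := takagi_midpoint hr 0 0
    rw [pow_zero, div_one, div_one, takagi_natCast, takagi_natCast] at hm
    refine key 0 _ 0 hq ?_ ?_ ?_
    · rw [pow_zero, div_one, takagi_natCast]; exact left_mem_uIcc
    · rw [hm]; simp
    · rw [pow_zero, div_one, takagi_natCast]; exact left_mem_uIcc
  | succ n ih =>
    obtain ⟨h0, h1⟩ := ih fun j hj hjn => hD j hj (by omega)
    refine key (n + 1) _ _ (natFloor_two_pow_succ _ x) h0 ?_ h1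
    refine uIcc_subset_uIcc h0 h1 (takagi_midpoint_mem_uIcc hr _ _ ?_)
    rw [Dfun_floor r hx.1 le_rfl]
    exact hD _ (by omega) le_rfl

lemma eq_left_endpoint_of_mem_XSet (hr : ∀ n, r n = 1 ∨ r n = -1) {x : ℝ} (hx : x ∈ XSet r)
    (hx1 : x < 1) {n : ℕ} (hn : 1 ≤ n) (h0 : Dfun r n x = 0)
    (hmin : ∀ j, 1 ≤ j → j < n → Dfun r j x ≠ 0) :
    x = (⌊2 ^ n * x⌋₊ : ℝ) / 2 ^ n := by
  have hx0 : 0 ≤ x := hx.1.1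
  by_contra hne
  obtain ⟨hl, hu⟩ := mem_Ico_floor hx0 n
  have hl' := lt_of_le_of_ne hl (Ne.symm hne)
  obtain ⟨z, hz, hd⟩ := exists_int_Dfun_eq hr n x
  have hz0 : z = 0 := by rw [h0] at hz; exact_mod_cast hz.symm
  obtain ⟨m, rfl⟩ : ∃ m, n = 2 * m := ⟨n / 2, by omega⟩
  refine hx.2 (mem_iUnion₂.2 ⟨(⌊2 ^ (2 * m) * x⌋₊, m), ⟨⟨?_, ?_⟩, ?_⟩, hl', by exact_mod_cast hu⟩)
  · rw [Nat.floor_lt (by positivity)]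
    push_cast
    exact mul_lt_of_lt_one_right (by positivity) hx1
  · rw [Dfun_floor r hx0 le_rfl, h0]
  · rw [generation, ncard_eq_one]
    refine ⟨2 * m, ext fun j => ⟨?_, ?_⟩⟩
    · rintro ⟨hj1, hj2, hj3⟩
      by_contra hj
      exact hmin j hj1 (lt_of_le_of_ne hj2 hj) (by rwa [Dfun_floor r hx0 hj2] at hj3)
    · rintro rfl
      exact ⟨hn, le_rfl, by rw [Dfun_floor r hx0 le_rfl, h0]⟩

lemma takagi_mem_of_mem_XSet (hr : ∀ n, r n = 1 ∨ r n = -1) {x : ℝ} (hx : x ∈ XSet r) :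
    takagi r x ∈ uIcc 0 (r 0 / 2) := by
  have hx0 : 0 ≤ x := hx.1.1
  rcases hx.1.2.eq_or_lt with h | h
  · have := takagi_natCast r 1
    rw [Nat.cast_one] at this
    rw [h, this]; exact left_mem_uIcc
  by_cases hex : ∃ n, 1 ≤ n ∧ Dfun r n x = 0
  · classical
    have hmin : ∀ j, 1 ≤ j → j < Nat.find hex → Dfun r j x ≠ 0 := fun j h1 hj h0 =>
      Nat.find_min hex hj ⟨h1, h0⟩
    obtain ⟨hn, h0⟩ := Nat.find_spec hex
    obtain ⟨n, hn'⟩ : ∃ n, Nat.find hex = n + 1 := ⟨Nat.find hex - 1, by omega⟩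
    rw [hn'] at hn h0 hmin
    have := eq_left_endpoint_of_mem_XSet hr hx h hn h0 hmin
    rw [this]
    exact (takagi_endpoints_mem hr ⟨hx0, h⟩ n fun j h1 h2 => hmin j h1 (by omega)).1
  · push Not at hex
    have hlim : Tendsto (fun n : ℕ => (⌊2 ^ (n + 1) * x⌋₊ : ℝ) / 2 ^ (n + 1)) atTop (𝓝 x) := by
      have ht : Tendsto (fun n : ℕ => (2 : ℝ) ^ (n + 1)) atTop atTop :=
        (tendsto_pow_atTop_atTop_of_one_lt (by norm_num)).comp (tendsto_add_atTop_nat 1)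
      have := (tendsto_nat_floor_mul_div_atTop hx0).comp ht
      refine this.congr fun n => ?_
      simp [mul_comm]
    exact isClosed_Icc.mem_of_tendsto ((continuous_takagi hr).tendsto x |>.comp hlim)
      (Eventually.of_forall fun n => (takagi_endpoints_mem hr ⟨hx0, h⟩ n fun j h1 _ => hex j h1).1)

/-- A point belongs to `XSet r` if at every level it is a dyadic point of that level or lies in a
closed dyadic interval of nonzero slope. -/
lemma mem_XSet_of_forall {x : ℝ} (hx : x ∈ Icc (0 : ℝ) 1)
    (h : ∀ n, 1 ≤ n → (∃ k : ℕ, x ∈ Icc ((k : ℝ) / 2 ^ n) (((k + 1 : ℕ) : ℝ) / 2 ^ n) ∧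
      Dfun r n ((k : ℝ) / 2 ^ n) ≠ 0) ∨ ∃ k : ℕ, x = k / 2 ^ n) : x ∈ XSet r := by
  refine ⟨hx, fun hmem => ?_⟩
  obtain ⟨⟨k, m⟩, ⟨⟨-, hD⟩, hgen⟩, hl, hu⟩ := mem_iUnion₂.1 hmem
  dsimp only at hD hgen hl hu
  have hm : 1 ≤ 2 * m := by
    rw [generation, ncard_eq_one] at hgen
    obtain ⟨a, ha⟩ := hgen
    obtain ⟨h1, h2, -⟩ := ha.ge (mem_singleton a)
    omega
  have hp : (0 : ℝ) < 2 ^ (2 * m) := by positivity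
  rcases h _ hm with ⟨k', ⟨hl', hu'⟩, hD'⟩ | ⟨k', rfl⟩
  · have h1 := (div_lt_div_iff_of_pos_right hp).1 (hl.trans_le hu')
    have h2 := (div_lt_div_iff_of_pos_right hp).1 (hl'.trans_lt hu)
    have h1' : k < k' + 1 := by exact_mod_cast h1
    have h2' : k' < k + 1 := by exact_mod_cast h2
    obtain rfl : k = k' := by omega
    exact hD' hD
  · have h1 := (div_lt_div_iff_of_pos_right hp).1 hl
    have h2 := (div_lt_div_iff_of_pos_right hp).1 hu
    have h1' : k < k' := by exact_mod_cast h1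
    have h2' : k' < k + 1 := by exact_mod_cast h2
    omega

/-- Bisection: nested dyadic intervals on which the Takagi function brackets a given value. -/
lemma exists_bracketing_seq (hr : ∀ n, r n = 1 ∨ r n = -1) {y : ℝ} (hy : y ∈ uIcc 0 (r 0 / 2)) :
    ∃ k : ℕ → ℕ, k 0 = 0 ∧ (∀ n, k (n + 1) = 2 * k n ∨ k (n + 1) = 2 * k n + 1) ∧
      ∀ n, y ∈ uIcc (takagi r ((k n : ℝ) / 2 ^ (n + 1)))
        (takagi r (((k n + 1 : ℕ) : ℝ) / 2 ^ (n + 1))) := by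
  have step : ∀ n k : ℕ, ∃ k' : ℕ, (k' = 2 * k ∨ k' = 2 * k + 1) ∧
      (y ∈ uIcc (takagi r ((k : ℝ) / 2 ^ (n + 1))) (takagi r (((k + 1 : ℕ) : ℝ) / 2 ^ (n + 1))) →
      y ∈ uIcc (takagi r ((k' : ℝ) / 2 ^ (n + 1 + 1)))
        (takagi r (((k' + 1 : ℕ) : ℝ) / 2 ^ (n + 1 + 1)))) := by
    intro n k
    have double : ∀ q : ℕ, (q : ℝ) / 2 ^ (n + 1) = ((2 * q : ℕ) : ℝ) / 2 ^ (n + 1 + 1) := by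
      intro q; push_cast; rw [pow_succ _ (n + 1)]; field_simp
    by_cases h : y ∈ uIcc (takagi r (((2 * k : ℕ) : ℝ) / 2 ^ (n + 1 + 1)))
        (takagi r (((2 * k + 1 : ℕ) : ℝ) / 2 ^ (n + 1 + 1)))
    · exact ⟨2 * k, Or.inl rfl, fun _ => h⟩
    · refine ⟨2 * k + 1, Or.inr rfl, fun hk => ?_⟩
      rw [double, double] at hk
      exact (uIcc_subset_uIcc_union_uIcc hk).resolve_left h
  choose next hnext hmem using step
  refine ⟨fun n => Nat.rec 0 next n, rfl, fun n => hnext n _, fun n => ?_⟩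
  induction n with
  | zero =>
    have h0 := takagi_natCast r 0
    have h1 := takagi_midpoint hr 0 0
    rw [pow_zero, div_one, div_one, takagi_natCast, takagi_natCast] at h1
    simp at h0 h1
    simpa [h0, h1] using hy
  | succ n ih => exact hmem n _ ih

lemma exists_mem_XSet_takagi_eq (hr : ∀ n, r n = 1 ∨ r n = -1) {y : ℝ}
    (hy : y ∈ uIcc 0 (r 0 / 2)) : ∃ x ∈ XSet r, takagi r x = y := by
  obtain ⟨k, hk0, hk, hky⟩ := exists_bracketing_seq hr hy
  set I : ℕ → Set ℝ := fun n =>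
    Icc ((k n : ℝ) / 2 ^ (n + 1)) (((k n + 1 : ℕ) : ℝ) / 2 ^ (n + 1)) with hI
  have hle : ∀ n, (k n : ℝ) / 2 ^ (n + 1) ≤ ((k n + 1 : ℕ) : ℝ) / 2 ^ (n + 1) := by
    intro n; gcongr; omega
  have hanti : Antitone I := by
    refine antitone_nat_of_succ_le fun n => ?_
    have hp : (0 : ℝ) < 2 ^ (n + 1) := by positivity
    apply Icc_subset_Icc <;> rw [pow_succ _ (n + 1), div_le_div_iff₀ (by positivity) (by positivity)]
    · have : (2 * k n : ℝ) ≤ k (n + 1) := by exact_mod_cast (by have := hk n; omega)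
      nlinarith
    · have : ((k (n + 1) + 1 : ℕ) : ℝ) ≤ 2 * (k n + 1 : ℕ) := by
        exact_mod_cast (by have := hk n; omega)
      nlinarith
  have hI0 : I 0 ⊆ Icc 0 1 := by
    rw [hI]; simp only [hk0]; apply Icc_subset_Icc <;> norm_num
  by_cases hex : ∃ n, Dfun r (n + 1) ((k n : ℝ) / 2 ^ (n + 1)) = 0
  · classical
    have hN := Nat.find_spec hex
    have hmin : ∀ n < Nat.find hex, _ := fun n hn => Nat.find_min hex hn
    set N := Nat.find hex
    have hx : (k N : ℝ) / 2 ^ (N + 1) ∈ I N := ⟨le_rfl, hle N⟩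
    refine ⟨(k N : ℝ) / 2 ^ (N + 1), mem_XSet_of_forall (hI0 (hanti (Nat.zero_le _) hx)) ?_, ?_⟩
    · intro n hn
      obtain ⟨n, rfl⟩ := Nat.exists_eq_add_of_le' hn
      rcases lt_or_ge n N with h | h
      · exact Or.inl ⟨k n, hanti h.le hx, hmin n h⟩
      · obtain ⟨p, rfl⟩ := Nat.exists_eq_add_of_le h
        refine Or.inr ⟨k N * 2 ^ p, ?_⟩
        push_cast
        field_simp
        ring
    · have hs := takagi_sub hr (N + 1) (k N)
      rw [hN, zero_div, sub_eq_zero] at hs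
      have := hky N
      rw [hs, uIcc_self] at this
      exact this.symm
  · push Not at hex
    have hx := ciSup_mem_iInter_Icc_of_antitone_Icc hanti hle
    set x := ⨆ n, (k n : ℝ) / 2 ^ (n + 1)
    have hx' : ∀ n, x ∈ I n := mem_iInter.1 hx
    refine ⟨x, mem_XSet_of_forall (hI0 (hx' 0)) ?_, ?_⟩
    · intro n hn
      obtain ⟨n, rfl⟩ := Nat.exists_eq_add_of_le' hn
      exact Or.inl ⟨k n, hx' n, hex n⟩
    · have hgap : Tendsto (fun n : ℕ => ((1 : ℝ) / 2) ^ (n + 1)) atTop (𝓝 0) :=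
        (tendsto_pow_atTop_nhds_zero_of_lt_one (by norm_num) (by norm_num)).comp
          (tendsto_add_atTop_nat 1)
      have hwidth : ∀ n, ((k n + 1 : ℕ) : ℝ) / 2 ^ (n + 1) =
          (k n : ℝ) / 2 ^ (n + 1) + (1 / 2) ^ (n + 1) := by
        intro n; push_cast; rw [one_div_pow]; ring
      have ha : Tendsto (fun n => (k n : ℝ) / 2 ^ (n + 1)) atTop (𝓝 x) := by
        refine tendsto_of_tendsto_of_tendsto_of_le_of_le (g := fun n => x - (1 / 2) ^ (n + 1))
          (by simpa using tendsto_const_nhds.sub hgap) tendsto_const_nhds (fun n => ?_)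
          fun n => (hx' n).1
        have := (hx' n).2
        rw [hwidth] at this
        simp only
        linarith
      have hb : Tendsto (fun n => ((k n + 1 : ℕ) : ℝ) / 2 ^ (n + 1)) atTop (𝓝 x) := by
        simp only [hwidth]
        simpa using ha.add hgap
      have hc := (continuous_takagi hr).tendsto x
      have hfa := hc.comp ha
      have hfb := hc.comp hb
      have hmin := hfa.min hfb
      have hmax := hfa.max hfb
      rw [min_self] at hmin
      rw [max_self] at hmax
      exact le_antisymm (le_of_tendsto' hmin fun n => (hky n).1)
        (ge_of_tendsto' hmax fun n => (hky n).2)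

lemma takagi_image_XSet_eq_uIcc (hr : ∀ n, r n = 1 ∨ r n = -1) :
    takagi r '' XSet r = uIcc 0 (r 0 / 2) :=
  Subset.antisymm (image_subset_iff.2 fun _ hx => takagi_mem_of_mem_XSet hr hx)
    fun _ hy => exists_mem_XSet_takagi_eq hr hy

end Takagi

/-- If `r_0 = 1` then `f(X) = [0, 1/2]`, and if `r_0 = -1` then
`f(X) = [-1/2, 0]`. -/
theorem takagi_image_XSet (r : ℕ → ℝ) (hr : ∀ n, r n = 1 ∨ r n = -1) :
    (r 0 = 1 → takagi r '' XSet r = Set.Icc 0 (1 / 2)) ∧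
    (r 0 = -1 → takagi r '' XSet r = Set.Icc (-(1 / 2)) 0) := by
  rw [takagi_image_XSet_eq_uIcc hr]
  constructor
  · intro h
    rw [h, uIcc_of_le (by norm_num)]
  · intro h
    rw [h, uIcc_of_ge (by norm_num), neg_div]
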